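/- arXiv:1209.2316 — 2 statements merged into one kernel-verified Lean document; each statement's English description precedes it below -/
import Mathlib

section
/- Let V be a real inner product space with inner product ⟨·,·⟩ and induced norm ‖·‖, let |||·||| be a further norm on V, and let T : V → [0,∞). Let C_coer, C_N, c₁, c₂ > 0. Assume: (i) B : V × V → ℝ is bilinear and B(v,v) ≥ C_coer |||v|||² for every v ∈ V; (ii) for every ε > 0 and every v ∈ V, T(v)² ≤ c₁ ε |||v|||² + c₂ ε^{-1} ‖v‖²; (iii) N : V × V → ℝ is linear in its second argument and satisfies |N(v,z) − N(w,z)| ≤ C_N (T(v−w)² + T(z)²) for all v, w, z ∈ V. Then for every λ ≥ 8 C_N² c₁ c₂ / C_coer and all v, w ∈ V: B(v−w, v−w) + λ ⟨v−w, v−w⟩ + N(v, v−w) − N(w, v−w) ≥ (C_coer/2) |||v−w|||². -/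
open scoped RealInnerProductSpace

/-- Abstract strong monotonicity of the dG bilinear form plus nonlinear interface form:
under coercivity of `B`, the trace estimate for `T`, and the Lipschitz-type bound on `N`,
for `λ ≥ 8 C_N² c₁ c₂ / C_coer` one has
`B(v−w,v−w) + λ⟨v−w,v−w⟩ + N(v,v−w) − N(w,v−w) ≥ (C_coer/2)|||v−w|||²`. -/
theorem stmt_6 {V : Type*} [NormedAddCommGroup V] [InnerProductSpace ℝ V]
    -- `tn` is a further norm `|||·|||` on `V`
    (tn : V → ℝ)
    (htn_add : ∀ v w : V, tn (v + w) ≤ tn v + tn w)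
    (htn_smul : ∀ (c : ℝ) (v : V), tn (c • v) = |c| * tn v)
    (htn_def : ∀ v : V, tn v = 0 → v = 0)
    (T : V → ℝ) (hT_nonneg : ∀ v : V, 0 ≤ T v)
    (Ccoer CN c₁ c₂ : ℝ)
    (hCcoer : 0 < Ccoer) (hCN : 0 < CN) (hc₁ : 0 < c₁) (hc₂ : 0 < c₂)
    (B : V →ₗ[ℝ] V →ₗ[ℝ] ℝ)
    (hB_coer : ∀ v : V, Ccoer * tn v ^ 2 ≤ B v v)
    (hT : ∀ ε : ℝ, 0 < ε → ∀ v : V, T v ^ 2 ≤ c₁ * ε * tn v ^ 2 + c₂ * ε⁻¹ * ‖v‖ ^ 2)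
    (N : V → V →ₗ[ℝ] ℝ)
    (hN : ∀ v w z : V, |N v z - N w z| ≤ CN * (T (v - w) ^ 2 + T z ^ 2)) :
    ∀ lam : ℝ, 8 * CN ^ 2 * c₁ * c₂ / Ccoer ≤ lam →
      ∀ v w : V,
        Ccoer / 2 * tn (v - w) ^ 2 ≤
          B (v - w) (v - w) + lam * ⟪v - w, v - w⟫ + N v (v - w) - N w (v - w) := by
  intro lam hlam v w
  have h1 := hT (Ccoer / (4 * CN * c₁)) (by positivity) (v - w)
  have h2 := (abs_le.mp (hN v w (v - w))).1
  have h3 := hB_coer (v - w)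
  rw [real_inner_self_eq_norm_sq]
  have h4 := mul_le_mul_of_nonneg_right hlam (sq_nonneg ‖v - w‖)
  have h5 := mul_le_mul_of_nonneg_left h1 (by positivity : (0 : ℝ) ≤ 2 * CN)
  have h6 : 2 * CN * (c₁ * (Ccoer / (4 * CN * c₁)) * tn (v - w) ^ 2
      + c₂ * (Ccoer / (4 * CN * c₁))⁻¹ * ‖v - w‖ ^ 2)
      = Ccoer / 2 * tn (v - w) ^ 2 + 8 * CN ^ 2 * c₁ * c₂ / Ccoer * ‖v - w‖ ^ 2 := by
    field_simp
    ring
  rw [h6] at h5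
  linarith
end

section
/- Let V be a finite-dimensional real inner product space with inner product ⟨·,·⟩ and induced norm ‖·‖, let |||·||| be a further norm on V, and let T : V → [0,∞). Let C_coer, C_N, c₁, c₂ > 0. Assume: (i) B : V × V → ℝ is bilinear with B(v,v) ≥ C_coer |||v|||² for every v ∈ V; (ii) for every ε > 0 and every v ∈ V, T(v)² ≤ c₁ ε |||v|||² + c₂ ε^{-1} ‖v‖²; (iii) N : V × V → ℝ is linear in its second argument, continuous in its first argument, and satisfies |N(v,z) − N(w,z)| ≤ C_N (T(v−w)² + T(z)²) for all v, w, z ∈ V. Then for every λ > 8 C_N² c₁ c₂ / C_coer and every linear functional ℓ : V → ℝ there exists a unique w_h ∈ V such that B(w_h, v) + λ ⟨w_h, v⟩ + N(w_h, v) = ℓ(v) for all v ∈ V. -/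
open scoped RealInnerProductSpace

/-- Zarantonello: a Lipschitz strongly monotone map has a zero. -/
lemma exists_zero_of_strongMono {V : Type*} [NormedAddCommGroup V] [InnerProductSpace ℝ V]
    [CompleteSpace V] (F : V → V) (m L : ℝ) (hm : 0 < m) (hL : 0 < L)
    (hmono : ∀ v w : V, m * ‖v - w‖ ^ 2 ≤ ⟪F v - F w, v - w⟫)
    (hlip : ∀ v w : V, ‖F v - F w‖ ≤ L * ‖v - w‖) : ∃ x, F x = 0 := by
  set ρ : ℝ := m / L ^ 2 with hρ
  have hρ0 : 0 < ρ := by positivity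
  set k : ℝ := 1 - m ^ 2 / L ^ 2 with hk
  have hk1 : k < 1 := by
    have : 0 < m ^ 2 / L ^ 2 := by positivity
    linarith
  have hsq : ∀ v w : V, ‖(v - ρ • F v) - (w - ρ • F w)‖ ^ 2 ≤ k * ‖v - w‖ ^ 2 := by
    intro v w
    have e : (v - ρ • F v) - (w - ρ • F w) = (v - w) - ρ • (F v - F w) := by
      rw [smul_sub]; abel
    rw [e, norm_sub_sq_real, inner_smul_right, norm_smul, real_inner_comm, Real.norm_eq_abs,
      mul_pow, sq_abs]
    have h1 := mul_le_mul_of_nonneg_left (hmono v w) hρ0.le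
    have h2 : ‖F v - F w‖ ^ 2 ≤ L ^ 2 * ‖v - w‖ ^ 2 := by
      rw [← mul_pow]
      exact pow_le_pow_left₀ (norm_nonneg _) (hlip v w) 2
    have h3 := mul_le_mul_of_nonneg_left h2 (sq_nonneg ρ)
    have h4 : k * ‖v - w‖ ^ 2 = ‖v - w‖ ^ 2 - 2 * (ρ * (m * ‖v - w‖ ^ 2))
        + ρ ^ 2 * (L ^ 2 * ‖v - w‖ ^ 2) := by
      rw [hk, hρ]; field_simp; ring
    linarith
  have hc : ContractingWith (Real.toNNReal (√k)) (fun v => v - ρ • F v) := by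
    constructor
    · rw [Real.toNNReal_lt_one, Real.sqrt_lt' one_pos]
      simpa using hk1
    · apply LipschitzWith.of_dist_le_mul
      intro v w
      rw [dist_eq_norm, dist_eq_norm, Real.coe_toNNReal _ (Real.sqrt_nonneg _)]
      have := Real.sqrt_le_sqrt (hsq v w)
      rwa [Real.sqrt_sq (norm_nonneg _), Real.sqrt_mul' _ (sq_nonneg _),
        Real.sqrt_sq (norm_nonneg _)] at this
  have : Nonempty V := ⟨0⟩
  refine ⟨hc.fixedPoint, ?_⟩
  have h := hc.fixedPoint_isFixedPt
  have h' : hc.fixedPoint - ρ • F hc.fixedPoint = hc.fixedPoint := h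
  have h2 : ρ • F hc.fixedPoint = 0 := by simpa using h'
  exact (smul_eq_zero.mp h2).resolve_left hρ0.ne'

/-- Abstract well-posedness of the elliptic projection (Lemma 4.4): on a
finite-dimensional space, for `λ > 8 C_N² c₁ c₂ / C_coer` and any linear functional `ℓ`
there is a unique `w_h` with `B(w_h, v) + λ⟨w_h, v⟩ + N(w_h, v) = ℓ(v)` for all `v`. -/
theorem stmt_9 {V : Type*} [NormedAddCommGroup V] [InnerProductSpace ℝ V]
    [FiniteDimensional ℝ V]
    -- `tn` is a further norm `|||·|||` on `V`
    (tn : V → ℝ)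
    (htn_add : ∀ v w : V, tn (v + w) ≤ tn v + tn w)
    (htn_smul : ∀ (c : ℝ) (v : V), tn (c • v) = |c| * tn v)
    (htn_def : ∀ v : V, tn v = 0 → v = 0)
    (T : V → ℝ) (hT_nonneg : ∀ v : V, 0 ≤ T v)
    (Ccoer CN c₁ c₂ : ℝ)
    (hCcoer : 0 < Ccoer) (hCN : 0 < CN) (hc₁ : 0 < c₁) (hc₂ : 0 < c₂)
    (B : V →ₗ[ℝ] V →ₗ[ℝ] ℝ)
    (hB_coer : ∀ v : V, Ccoer * tn v ^ 2 ≤ B v v)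
    (hT : ∀ ε : ℝ, 0 < ε → ∀ v : V, T v ^ 2 ≤ c₁ * ε * tn v ^ 2 + c₂ * ε⁻¹ * ‖v‖ ^ 2)
    (N : V → V →ₗ[ℝ] ℝ)
    (hN_cont : ∀ z : V, Continuous fun v : V => N v z)
    (hN : ∀ v w z : V, |N v z - N w z| ≤ CN * (T (v - w) ^ 2 + T z ^ 2)) :
    ∀ lam : ℝ, 8 * CN ^ 2 * c₁ * c₂ / Ccoer < lam →
      ∀ ℓ : V →ₗ[ℝ] ℝ,
        ∃! wh : V, ∀ v : V, B wh v + lam * ⟪wh, v⟫ + N wh v = ℓ v := by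
  intro lam hlam ℓ
  have : CompleteSpace V := FiniteDimensional.complete ℝ V
  -- boundedness of B
  obtain ⟨β, hβ0, hβ⟩ : ∃ β : ℝ, 0 ≤ β ∧ ∀ v z : V, |B v z| ≤ β * ‖v‖ * ‖z‖ := by
    let B' : V →L[ℝ] V →L[ℝ] ℝ := LinearMap.toContinuousLinearMap
      ((LinearMap.toContinuousLinearMap (𝕜 := ℝ) (E := V) (F' := ℝ)).toLinearMap ∘ₗ B)
    exact ⟨‖B'‖, B'.opNorm_nonneg, fun v z => B'.le_opNorm₂ v z⟩
  have htn2 : ∀ v : V, tn v ^ 2 ≤ β / Ccoer * ‖v‖ ^ 2 := by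
    intro v
    have h1 := hB_coer v
    have h2 := (le_abs_self _).trans (hβ v v)
    rw [div_mul_eq_mul_div, le_div_iff₀ hCcoer]
    nlinarith
  obtain ⟨τ, hτ0, hτ⟩ : ∃ τ : ℝ, 0 ≤ τ ∧ ∀ v : V, T v ^ 2 ≤ τ * ‖v‖ ^ 2 := by
    refine ⟨c₁ * (β / Ccoer) + c₂, by positivity, fun v => ?_⟩
    have h1 := hT 1 one_pos v
    have h2 := mul_le_mul_of_nonneg_left (htn2 v) hc₁.le
    simp only [inv_one, mul_one] at h1
    linarith
  -- N is Lipschitz by scaling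
  have hNlip : ∀ v w z : V, |N v z - N w z| ≤ 2 * CN * τ * ‖v - w‖ * ‖z‖ := by
    intro v w z
    rcases eq_or_ne z 0 with rfl | hz
    · simp
    rcases eq_or_ne v w with rfl | hvw
    · simp
    have hz' : 0 < ‖z‖ := norm_pos_iff.mpr hz
    have hd : 0 < ‖v - w‖ := norm_pos_iff.mpr (sub_ne_zero.mpr hvw)
    set t : ℝ := ‖v - w‖ / ‖z‖ with ht
    have ht0 : 0 < t := by positivity
    have h1 := hN v w (t • z)
    rw [map_smul, map_smul, smul_eq_mul, smul_eq_mul, ← mul_sub, abs_mul, abs_of_pos ht0] at h1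
    have h2 := hτ (v - w)
    have h3 := hτ (t • z)
    have h4 : ‖t • z‖ = ‖v - w‖ := by
      rw [norm_smul, Real.norm_eq_abs, abs_of_pos ht0, ht]; field_simp
    rw [h4] at h3
    have h5 : t * |N v z - N w z| ≤ CN * (τ * ‖v - w‖ ^ 2 + τ * ‖v - w‖ ^ 2) :=
      h1.trans (mul_le_mul_of_nonneg_left (add_le_add h2 h3) hCN.le)
    refine le_of_mul_le_mul_left (h5.trans (le_of_eq ?_)) ht0
    rw [ht]; field_simp; ring
  -- strong monotonicity
  set m : ℝ := lam - 4 * CN ^ 2 * c₁ * c₂ / Ccoer with hm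
  have hm0 : 0 < m := by
    have h1 : 0 < 4 * CN ^ 2 * c₁ * c₂ / Ccoer := by positivity
    have h2 : 8 * CN ^ 2 * c₁ * c₂ / Ccoer = 2 * (4 * CN ^ 2 * c₁ * c₂ / Ccoer) := by ring
    linarith
  have hmono : ∀ v w : V, m * ‖v - w‖ ^ 2 ≤
      B (v - w) (v - w) + lam * ‖v - w‖ ^ 2 + (N v (v - w) - N w (v - w)) := by
    intro v w
    have h1 := hB_coer (v - w)
    have h2 := (neg_abs_le (N v (v - w) - N w (v - w)))
    have h3 := hN v w (v - w)
    have h4 := hT (Ccoer / (2 * CN * c₁)) (by positivity) (v - w)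
    have h5 := mul_le_mul_of_nonneg_left h4 (by positivity : 0 ≤ 2 * CN)
    have h6 : 2 * CN * (c₁ * (Ccoer / (2 * CN * c₁)) * tn (v - w) ^ 2
        + c₂ * (Ccoer / (2 * CN * c₁))⁻¹ * ‖v - w‖ ^ 2)
        = Ccoer * tn (v - w) ^ 2 + 4 * CN ^ 2 * c₁ * c₂ / Ccoer * ‖v - w‖ ^ 2 := by
      field_simp; ring
    rw [h6] at h5
    rw [hm, sub_mul]
    linarith
  -- Riesz representation of the residual
  let R : V → (V →ₗ[ℝ] ℝ) := fun v => B v + lam • (innerₗ V v) + N v - ℓ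
  have hR : ∀ v z, R v z = B v z + lam * ⟪v, z⟫ + N v z - ℓ z := fun v z => by simp [R]
  let F : V → V := fun v =>
    (InnerProductSpace.toDual ℝ V).symm (LinearMap.toContinuousLinearMap (R v))
  have hF : ∀ v z, ⟪F v, z⟫ = R v z := fun v z => by
    simp [F, InnerProductSpace.toDual_symm_apply]
  have hlam0 : 0 < lam := lt_trans (by positivity) hlam
  have hdiff : ∀ v w z, ⟪F v - F w, z⟫ =
      B (v - w) z + lam * ⟪v - w, z⟫ + (N v z - N w z) := by
    intro v w z
    rw [inner_sub_left, hF, hF, hR, hR, map_sub, LinearMap.sub_apply, inner_sub_left]; ring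
  obtain ⟨x, hx⟩ := exists_zero_of_strongMono F m (β + lam + 2 * CN * τ) hm0 (by positivity)
    (fun v w => by
      rw [hdiff, real_inner_self_eq_norm_sq]; exact hmono v w)
    (fun v w => by
      set z := F v - F w with hz
      rcases (norm_nonneg z).eq_or_lt with h0 | h0
      · rw [← h0]; positivity
      have h1 := hdiff v w z
      rw [← hz, real_inner_self_eq_norm_sq] at h1
      have h2 := (le_abs_self _).trans (hβ (v - w) z)
      have h3 := mul_le_mul_of_nonneg_left (real_inner_le_norm (v - w) z) hlam0.le
      have h4 := (le_abs_self _).trans (hNlip v w z)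
      refine le_of_mul_le_mul_right ?_ h0
      nlinarith)
  refine ⟨x, fun v => ?_, fun y hy => ?_⟩
  · have h := hF x v
    rw [hx, inner_zero_left, hR] at h
    linarith
  · have hFy : F y = 0 := by
      have h := hF y (F y)
      rw [hR, hy, sub_self] at h
      exact inner_self_eq_zero.mp h
    have h1 := hmono y x
    have h2 := hdiff y x (y - x)
    rw [hFy, hx, sub_zero, inner_zero_left, real_inner_self_eq_norm_sq] at h2
    have h3 : ‖y - x‖ ^ 2 ≤ 0 := by
      rw [← h2] at h1
      exact nonpos_of_mul_nonpos_right h1 hm0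
    have h4 : ‖y - x‖ = 0 := by
      have := sq_nonneg ‖y - x‖
      exact pow_eq_zero_iff (two_ne_zero) |>.mp (le_antisymm h3 this)
    exact sub_eq_zero.mp (norm_eq_zero.mp h4)
end
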